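/- arXiv:2312.11113 — 6 statements merged into one kernel-verified Lean document; each statement's English description precedes it below -/
import Mathlib

section
/- Let (T, ⪯, f) be an order-theoretic merge tree equipped with a consistent layer-order (≤_h). Then the induced leaf-order ⊑_L is a total order on the set L(T) of leaves of T: it is reflexive, antisymmetric, transitive, and total. -/
/-- An order-theoretic merge tree: a partially ordered set with a real-valued
height function that is strictly monotone, whose ancestors form chains, and in
which every point can be lifted to any height above it. `up x h` is the
(necessarily unique) ancestor of `x` at height `h` (for `f x ≤ h`). -/
structure MergeTree (T : Type*) [PartialOrder T] where
  f : T → ℝ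
  up : T → ℝ → T
  strict_mono : ∀ {x y : T}, x < y → f x < f y
  chain : ∀ {x y z : T}, x ≤ y → x ≤ z → y ≤ z ∨ z ≤ y
  le_up : ∀ (x : T) (h : ℝ), f x ≤ h → x ≤ up x h
  f_up : ∀ (x : T) (h : ℝ), f x ≤ h → f (up x h) = h

/-- A consistent layer-order on a merge tree: for every height `h`, a total
order on the level set `T_h = {x | f x = h}`, consistent with lifting. -/
structure LayerOrder {T : Type*} [PartialOrder T] (M : MergeTree T) where
  le : ℝ → T → T → Prop
  refl : ∀ (h : ℝ) (x : T), M.f x = h → le h x x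
  antisymm : ∀ (h : ℝ) (x y : T), M.f x = h → M.f y = h → le h x y → le h y x → x = y
  trans : ∀ (h : ℝ) (x y z : T), M.f x = h → M.f y = h → M.f z = h →
    le h x y → le h y z → le h x z
  total : ∀ (h : ℝ) (x y : T), M.f x = h → M.f y = h → le h x y ∨ le h y x
  consistent : ∀ (h₁ h₂ : ℝ), h₁ ≤ h₂ → ∀ (x y : T), M.f x = h₁ → M.f y = h₁ →
    le h₁ x y → le h₂ (M.up x h₂) (M.up y h₂)

/-- A leaf of a merge tree is a minimal element. -/
def IsLeaf {T : Type*} [PartialOrder T] (x : T) : Prop := ∀ y : T, y ≤ x → y = x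

/-- The leaf-order on leaves induced by a layer-order:
`u1 ⊑_L u2` iff `u1^h ≤_h u2^h` where `h = max (f u1) (f u2)`. -/
def inducedLeafLe {T : Type*} [PartialOrder T] (M : MergeTree T)
    (lay : ℝ → T → T → Prop) (u1 u2 : T) : Prop :=
  lay (max (M.f u1) (M.f u2))
    (M.up u1 (max (M.f u1) (M.f u2))) (M.up u2 (max (M.f u1) (M.f u2)))

namespace MergeTree

variable {T : Type*} [PartialOrder T] (M : MergeTree T)

/-- Two ancestors of a point at the same height coincide. -/
theorem eq_of_le_of_le {x y z : T} (hy : x ≤ y) (hz : x ≤ z) (h : M.f y = M.f z) : y = z := by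
  rcases M.chain hy hz with hyz | hzy
  · exact hyz.eq_of_not_lt fun hlt => (M.strict_mono hlt).ne h
  · exact (hzy.eq_of_not_lt fun hlt => (M.strict_mono hlt).ne' h).symm

theorem up_self (x : T) : M.up x (M.f x) = x :=
  M.eq_of_le_of_le (M.le_up x _ le_rfl) le_rfl (M.f_up x _ le_rfl)

theorem up_up (x : T) {h k : ℝ} (hx : M.f x ≤ h) (hk : h ≤ k) :
    M.up (M.up x h) k = M.up x k := by
  have hf : M.f (M.up x h) ≤ k := (M.f_up x h hx).trans_le hk
  refine M.eq_of_le_of_le ((M.le_up x h hx).trans (M.le_up _ k hf)) (M.le_up x k (hx.trans hk)) ?_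
  rw [M.f_up _ k hf, M.f_up x k (hx.trans hk)]

/-- Distinct leaves have not merged yet at the height of the higher one. -/
theorem eq_of_isLeaf_of_up_eq {u v : T} (hu : IsLeaf u) (hv : IsLeaf v)
    (h : M.up u (max (M.f u) (M.f v)) = M.up v (max (M.f u) (M.f v))) : u = v := by
  rcases le_total (M.f u) (M.f v) with huv | hvu
  · rw [max_eq_right huv, M.up_self] at h
    exact hv u ((M.le_up u _ huv).trans_eq h)
  · rw [max_eq_left hvu, M.up_self] at h
    exact (hu v ((M.le_up v _ hvu).trans_eq h.symm)).symm

end MergeTree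

namespace LayerOrder

variable {T : Type*} [PartialOrder T] {M : MergeTree T} (L : LayerOrder M)

/-- The induced order on points is preserved by lifting to any sufficiently large height. -/
theorem le_up_up_of_inducedLeafLe {u v : T} (huv : inducedLeafLe M L.le u v) {h : ℝ}
    (hu : M.f u ≤ h) (hv : M.f v ≤ h) : L.le h (M.up u h) (M.up v h) := by
  have key := L.consistent _ h (max_le hu hv) _ _ (M.f_up u _ (le_max_left _ _))
    (M.f_up v _ (le_max_right _ _)) huv
  rwa [M.up_up u (le_max_left _ _) (max_le hu hv),
    M.up_up v (le_max_right _ _) (max_le hu hv)] at key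

theorem inducedLeafLe_total (u v : T) :
    inducedLeafLe M L.le u v ∨ inducedLeafLe M L.le v u := by
  unfold inducedLeafLe
  rw [max_comm (M.f v)]
  exact L.total _ _ _ (M.f_up u _ (le_max_left _ _)) (M.f_up v _ (le_max_right _ _))

theorem inducedLeafLe_antisymm {u v : T} (hu : IsLeaf u) (hv : IsLeaf v)
    (huv : inducedLeafLe M L.le u v) (hvu : inducedLeafLe M L.le v u) : u = v :=
  M.eq_of_isLeaf_of_up_eq hu hv <|
    L.antisymm _ _ _ (M.f_up u _ (le_max_left _ _)) (M.f_up v _ (le_max_right _ _)) huv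
      (L.le_up_up_of_inducedLeafLe hvu (le_max_right _ _) (le_max_left _ _))

theorem inducedLeafLe_trans {u v w : T} (hu : IsLeaf u) (hv : IsLeaf v)
    (huv : inducedLeafLe M L.le u v) (hvw : inducedLeafLe M L.le v w) :
    inducedLeafLe M L.le u w := by
  rcases le_total (M.f v) (max (M.f u) (M.f w)) with hle | hlt
  · exact L.trans _ _ _ _ (M.f_up u _ (le_max_left _ _)) (M.f_up v _ hle)
      (M.f_up w _ (le_max_right _ _))
      (L.le_up_up_of_inducedLeafLe huv (le_max_left _ _) hle)
      (L.le_up_up_of_inducedLeafLe hvw hle (le_max_right _ _))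
  · obtain ⟨hua, hwa⟩ := max_le_iff.mp hlt
    rcases L.inducedLeafLe_total u w with huw | hwu
    · exact huw
    · have hvu : L.le (M.f v) (M.up v (M.f v)) (M.up u (M.f v)) :=
        L.trans _ _ _ _ (M.f_up v _ le_rfl) (M.f_up w _ hwa) (M.f_up u _ hua)
          (L.le_up_up_of_inducedLeafLe hvw le_rfl hwa)
          (L.le_up_up_of_inducedLeafLe hwu hwa hua)
      have h : inducedLeafLe M L.le v u := by
        unfold inducedLeafLe
        rwa [max_eq_left hua]
      rwa [L.inducedLeafLe_antisymm hu hv huv h]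

end LayerOrder

/-- The induced leaf-order `⊑_L` is a total order on the set of
leaves: it is reflexive, antisymmetric, transitive and total on leaves. -/
theorem inducedLeafLe_isTotalOrder {T : Type*} [PartialOrder T]
    (M : MergeTree T) (L : LayerOrder M) :
    (∀ u : T, IsLeaf u → inducedLeafLe M L.le u u) ∧
    (∀ u v : T, IsLeaf u → IsLeaf v →
      inducedLeafLe M L.le u v → inducedLeafLe M L.le v u → u = v) ∧
    (∀ u v w : T, IsLeaf u → IsLeaf v → IsLeaf w →
      inducedLeafLe M L.le u v → inducedLeafLe M L.le v w → inducedLeafLe M L.le u w) ∧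
    (∀ u v : T, IsLeaf u → IsLeaf v →
      inducedLeafLe M L.le u v ∨ inducedLeafLe M L.le v u) := by
  exact ⟨fun u _ => (L.inducedLeafLe_total u u).elim id id,
    fun _ _ hu hv => L.inducedLeafLe_antisymm hu hv,
    fun _ _ _ hu hv _ => L.inducedLeafLe_trans hu hv,
    fun u v _ _ => L.inducedLeafLe_total u v⟩
end

section
/- Let (T, ⪯, f) be an order-theoretic merge tree in which any two points have a least upper bound and every point has a leaf below it, equipped with a leaf-order ⊑_L. Then for each h ∈ ℝ, the induced layer relation ≤_h is a total order on the level set T_h. -/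
/-- A leaf-order on a merge tree whose underlying order has binary least upper
bounds (`⊔` = lca): a total order on the leaves that separates subtrees. -/
structure LeafOrder (T : Type*) [SemilatticeSup T] where
  le : T → T → Prop
  refl : ∀ u : T, IsLeaf u → le u u
  antisymm : ∀ u v : T, IsLeaf u → IsLeaf v → le u v → le v u → u = v
  trans : ∀ u v w : T, IsLeaf u → IsLeaf v → IsLeaf w → le u v → le v w → le u w
  total : ∀ u v : T, IsLeaf u → IsLeaf v → le u v ∨ le v u
  separates : ∀ u u1 u2 : T, IsLeaf u → IsLeaf u1 → IsLeaf u2 →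
    le u1 u → le u u2 → u ≤ u1 ⊔ u2

/-- The layer relation induced by a relation `lle` on leaves:
`x1 ≤ x2` iff `x1 = x2` or every leaf below `x1` is `lle`-below every leaf
below `x2` (i.e. `L(T_{x1}) ⊑_L L(T_{x2})`). -/
def inducedLayerLe {T : Type*} [PartialOrder T] (lle : T → T → Prop)
    (x1 x2 : T) : Prop :=
  x1 = x2 ∨ ∀ u1 : T, IsLeaf u1 → u1 ≤ x1 → ∀ u2 : T, IsLeaf u2 → u2 ≤ x2 → lle u1 u2

/-- Two points of equal height with a common lower bound coincide. -/
theorem MergeTree.eq_of_le_of_le_s3 {T : Type*} [PartialOrder T] (M : MergeTree T) {u x y : T}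
    (hf : M.f x = M.f y) (hx : u ≤ x) (hy : u ≤ y) : x = y := by
  rcases M.chain hx hy with hxy | hyx
  · exact hxy.eq_of_not_lt fun hlt => (M.strict_mono hlt).ne hf
  · exact (hyx.eq_of_not_lt fun hlt => (M.strict_mono hlt).ne' hf).symm

/-- A leaf lying between two leaves below `x` is itself below `x`. -/
theorem LeafOrder.le_of_between {T : Type*} [SemilatticeSup T] (lo : LeafOrder T) {x u u1 u2 : T}
    (hu : IsLeaf u) (hu1 : IsLeaf u1) (hu2 : IsLeaf u2) (hx1 : u1 ≤ x) (hx2 : u2 ≤ x)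
    (h1 : lo.le u1 u) (h2 : lo.le u u2) : u ≤ x :=
  (lo.separates u u1 u2 hu hu1 hu2 h1 h2).trans (sup_le hx1 hx2)


/-- In a merge tree with binary least upper bounds in which every
point has a leaf below it, the layer relation induced by a leaf-order is, for
each height `h`, a total order on the level set `T_h`. -/
theorem inducedLayerLe_isTotalOrder {T : Type*} [SemilatticeSup T]
    (M : MergeTree T) (lo : LeafOrder T)
    (hleaf : ∀ x : T, ∃ u : T, IsLeaf u ∧ u ≤ x) (h : ℝ) :
    (∀ x : T, M.f x = h → inducedLayerLe lo.le x x) ∧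
    (∀ x y : T, M.f x = h → M.f y = h →
      inducedLayerLe lo.le x y → inducedLayerLe lo.le y x → x = y) ∧
    (∀ x y z : T, M.f x = h → M.f y = h → M.f z = h →
      inducedLayerLe lo.le x y → inducedLayerLe lo.le y z → inducedLayerLe lo.le x z) ∧
    (∀ x y : T, M.f x = h → M.f y = h →
      inducedLayerLe lo.le x y ∨ inducedLayerLe lo.le y x) := by
  refine ⟨fun x _ => Or.inl rfl, ?_, ?_, ?_⟩
  · rintro x y hx hy (hxy | hxy) (hyx | hyx)
    · exact hxy
    · exact hxy
    · exact hyx.symm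
    · obtain ⟨u, hu, hux⟩ := hleaf x
      obtain ⟨v, hv, hvy⟩ := hleaf y
      obtain rfl := lo.antisymm u v hu hv (hxy u hu hux v hv hvy) (hyx v hv hvy u hu hux)
      exact M.eq_of_le_of_le_s3 (hx.trans hy.symm) hux hvy
  · rintro x y z - - - (rfl | hxy) (rfl | hyz)
    · exact Or.inl rfl
    · exact Or.inr hyz
    · exact Or.inr hxy
    · obtain ⟨v, hv, hvy⟩ := hleaf y
      exact Or.inr fun u hu hux w hw hwz =>
        lo.trans u v w hu hv hw (hxy u hu hux v hv hvy) (hyz v hv hvy w hw hwz)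
  · intro x y hx hy
    by_contra! hne
    simp only [inducedLayerLe, not_or, not_forall] at hne
    obtain ⟨⟨hxy, a, ha, hax, b, hb, hby, hab⟩, -, c, hc, hcy, d, hd, hdx, hcd⟩ := hne
    have hba := (lo.total a b ha hb).resolve_left hab
    have hdc := (lo.total c d hc hd).resolve_left hcd
    have hf := hx.trans hy.symm
    rcases lo.total a c ha hc with hac | hca
    · exact hxy (M.eq_of_le_of_le_s3 hf hax (lo.le_of_between ha hb hc hby hcy hba hac))
    · exact hxy (M.eq_of_le_of_le_s3 hf (lo.le_of_between hc hd ha hdx hax hdc hca) hcy)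
end

section
/- Let (T, ⪯, f) be an order-theoretic merge tree in which any two points have a least upper bound and every point has a leaf below it, equipped with a consistent layer-order (≤_h). Let ⊑_L be the leaf-order induced by (≤_h), and let (≤'_h) be the layer-order induced by ⊑_L. Then (≤'_h) equals (≤_h): for every h ∈ ℝ and all x1, x2 ∈ T_h, x1 ≤_h x2 if and only if x1 ≤'_h x2. -/
namespace MergeTree

variable {T : Type*} [PartialOrder T] (M : MergeTree T)

theorem f_mono {x y : T} (hxy : x ≤ y) : M.f x ≤ M.f y := by
  rcases hxy.eq_or_lt with rfl | hlt
  · exact le_rfl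
  · exact (M.strict_mono hlt).le

theorem eq_of_le_of_f_eq {x y : T} (hxy : x ≤ y) (hf : M.f x = M.f y) : x = y :=
  hxy.eq_of_not_lt fun hlt => (M.strict_mono hlt).ne hf

/-- Two ancestors of a point at the same height coincide. -/
theorem ancestor_unique {u y z : T} (hy : u ≤ y) (hz : u ≤ z) (hf : M.f y = M.f z) : y = z := by
  rcases M.chain hy hz with hyz | hzy
  · exact M.eq_of_le_of_f_eq hyz hf
  · exact (M.eq_of_le_of_f_eq hzy hf.symm).symm

theorem up_up_eq {u x : T} {k : ℝ} (hux : u ≤ x) (huk : M.f u ≤ k) (hkx : k ≤ M.f x) :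
    M.up (M.up u k) (M.f x) = x := by
  have hk : M.f (M.up u k) ≤ M.f x := (M.f_up u k huk).trans_le hkx
  exact M.ancestor_unique ((M.le_up u k huk).trans (M.le_up _ _ hk)) hux (M.f_up _ _ hk)

end MergeTree

/-- A comparison of the leaves `u1`, `u2` lifts to their ancestors at a common height. -/
theorem LayerOrder.le_of_inducedLeafLe {T : Type*} [PartialOrder T] {M : MergeTree T}
    (L : LayerOrder M) {h : ℝ} {x1 x2 u1 u2 : T} (hx1 : M.f x1 = h) (hx2 : M.f x2 = h)
    (hu1 : u1 ≤ x1) (hu2 : u2 ≤ x2) (hle : inducedLeafLe M L.le u1 u2) : L.le h x1 x2 := by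
  have hm : max (M.f u1) (M.f u2) ≤ h :=
    max_le (hx1 ▸ M.f_mono hu1) (hx2 ▸ M.f_mono hu2)
  have hlift := L.consistent _ h hm _ _ (M.f_up u1 _ (le_max_left _ _))
    (M.f_up u2 _ (le_max_right _ _)) hle
  have e1 := M.up_up_eq hu1 (le_max_left _ (M.f u2)) (hm.trans_eq hx1.symm)
  have e2 := M.up_up_eq hu2 (le_max_right (M.f u1) _) (hm.trans_eq hx2.symm)
  rw [hx1] at e1
  rw [hx2] at e2
  rwa [e1, e2] at hlift

theorem LayerOrder.inducedLeafLe_total_s5 {T : Type*} [PartialOrder T] {M : MergeTree T}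
    (L : LayerOrder M) (u1 u2 : T) :
    inducedLeafLe M L.le u1 u2 ∨ inducedLeafLe M L.le u2 u1 := by
  unfold inducedLeafLe
  rw [max_comm (M.f u2) (M.f u1)]
  exact L.total _ _ _ (M.f_up u1 _ (le_max_left _ _)) (M.f_up u2 _ (le_max_right _ _))

/-- Starting from a consistent layer-order `(≤_h)`, taking the
induced leaf-order and then the induced layer-order recovers `(≤_h)`:
for all `x1, x2` at height `h`, `x1 ≤_h x2 ↔ x1 ≤'_h x2`. -/
theorem layer_to_leaf_to_layer {T : Type*} [SemilatticeSup T]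
    (M : MergeTree T) (L : LayerOrder M)
    (hleaf : ∀ x : T, ∃ u : T, IsLeaf u ∧ u ≤ x)
    (h : ℝ) (x1 x2 : T) (hx1 : M.f x1 = h) (hx2 : M.f x2 = h) :
    L.le h x1 x2 ↔ inducedLayerLe (inducedLeafLe M L.le) x1 x2 := by
  constructor
  · intro hle
    refine or_iff_not_imp_left.mpr fun hne u1 _ hu1 u2 _ hu2 => ?_
    refine (L.inducedLeafLe_total_s5 u1 u2).resolve_right fun hge => hne ?_
    exact L.antisymm h x1 x2 hx1 hx2 hle (L.le_of_inducedLeafLe hx2 hx1 hu2 hu1 hge)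
  · rintro (rfl | hall)
    · exact L.refl h x1 hx1
    · obtain ⟨u1, hl1, hu1⟩ := hleaf x1
      obtain ⟨u2, hl2, hu2⟩ := hleaf x2
      exact L.le_of_inducedLeafLe hx1 hx2 hu1 hu2 (hall u1 hl1 hu1 u2 hl2 hu2)
end

section
/- Let T be any type, f : T → ℝ, and σ : [0,1] → T any function. Then any two distinct maximal violating subcurves [ℓ1, r1] and [ℓ2, r2] of σ are interior-disjoint: the open intervals (ℓ1, r1) and (ℓ2, r2) are disjoint. -/
/-- `[l, r] ⊆ [0,1]` is a violating subcurve of `σ`: `l < r`, `σ l = σ r`, and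
`f (σ t) > f (σ l)` for all `t ∈ (l, r)`. -/
def IsViolating {T : Type*} (f : T → ℝ) (σ : Set.Icc (0:ℝ) 1 → T)
    (l r : Set.Icc (0:ℝ) 1) : Prop :=
  l < r ∧ σ l = σ r ∧ ∀ t : Set.Icc (0:ℝ) 1, l < t → t < r → f (σ l) < f (σ t)

/-- A violating subcurve is maximal if it is not properly contained in any
other violating subcurve of `σ`. -/
def IsMaximalViolating {T : Type*} (f : T → ℝ) (σ : Set.Icc (0:ℝ) 1 → T)
    (l r : Set.Icc (0:ℝ) 1) : Prop :=
  IsViolating f σ l r ∧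
    ∀ l' r' : Set.Icc (0:ℝ) 1, IsViolating f σ l' r' → l' ≤ l → r ≤ r' →
      l' = l ∧ r' = r

/-- A maximal violating subcurve `[l2, r2]` cannot start strictly inside another maximal
violating subcurve `[l1, r1]`. -/
theorem IsMaximalViolating.left_le_of_overlap {T : Type*} {f : T → ℝ}
    {σ : Set.Icc (0:ℝ) 1 → T} {l1 r1 l2 r2 : Set.Icc (0:ℝ) 1}
    (h1 : IsMaximalViolating f σ l1 r1) (h2 : IsMaximalViolating f σ l2 r2)
    (h : l2 < r1) : l2 ≤ l1 := by
  by_contra! hlt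
  rcases le_or_gt r2 r1 with hr | hr
  · exact hlt.ne (h2.2 l1 r1 h1.1 hlt.le hr).1
  · have hl := h1.1.2.2 l2 hlt h
    rw [h1.1.2.1] at hl
    exact lt_asymm hl (h2.1.2.2 r1 h hr)

/-- Any two distinct maximal violating subcurves of `σ` are
interior-disjoint. -/
theorem maximalViolating_interior_disjoint {T : Type*} (f : T → ℝ)
    (σ : Set.Icc (0:ℝ) 1 → T) (l1 r1 l2 r2 : Set.Icc (0:ℝ) 1)
    (h1 : IsMaximalViolating f σ l1 r1) (h2 : IsMaximalViolating f σ l2 r2)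
    (hne : (l1, r1) ≠ (l2, r2)) :
    Disjoint (Set.Ioo l1 r1) (Set.Ioo l2 r2) := by
  rw [Set.disjoint_left]
  rintro t ⟨hl1, hr1⟩ ⟨hl2, hr2⟩
  have hl : l1 = l2 := le_antisymm
    (h2.left_le_of_overlap h1 (hl1.trans hr2)) (h1.left_le_of_overlap h2 (hl2.trans hr1))
  rcases le_total r1 r2 with hr | hr
  · exact hne (Prod.ext hl (h1.2 l2 r2 h2.1 hl.ge hr).2.symm)
  · exact hne (Prod.ext hl (h2.2 l1 r1 h1.1 hl.le hr).2)
end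

section
/- Let P, Q : [0,1] → ℝ be 1D curves, δ ≥ 0, and let (φ, ψ) be a δ-interleaving of the sublevel filtrations of P and Q. Let y* := max(sup(range P), sup(range Q)) + 2δ and μ := φ_{y*} : [0,1] → [0,1]. Then μ is a δ-matching between P and Q: it is a continuous strictly increasing bijection and |P(x) − Q(μ(x))| ≤ δ for all x ∈ [0,1]. -/
/-- The sublevel set `S_P(y) = P⁻¹((-∞, y])` of a 1D curve `P : [0,1] → ℝ`. -/
def sublevel (P : Set.Icc (0:ℝ) 1 → ℝ) (y : ℝ) : Set (Set.Icc (0:ℝ) 1) :=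
  {t | P t ≤ y}

/-- A `δ`-interleaving of the sublevel filtrations of two 1D curves `P` and
`Q`: families of continuous, strictly increasing maps
`φ_y : S_P(y) → S_Q(y+δ)` and `ψ_y : S_Q(y) → S_P(y+δ)` that are natural
(compatible with inclusions) and satisfy the triangle identities. The maps are
modelled as total functions on `[0,1]`; only their restrictions to the
relevant sublevel sets are constrained. -/
structure SublevelInterleaving (P Q : Set.Icc (0:ℝ) 1 → ℝ) (δ : ℝ) where
  φ : ℝ → Set.Icc (0:ℝ) 1 → Set.Icc (0:ℝ) 1
  ψ : ℝ → Set.Icc (0:ℝ) 1 → Set.Icc (0:ℝ) 1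
  φ_maps : ∀ y : ℝ, Set.MapsTo (φ y) (sublevel P y) (sublevel Q (y + δ))
  ψ_maps : ∀ y : ℝ, Set.MapsTo (ψ y) (sublevel Q y) (sublevel P (y + δ))
  φ_cont : ∀ y : ℝ, ContinuousOn (φ y) (sublevel P y)
  ψ_cont : ∀ y : ℝ, ContinuousOn (ψ y) (sublevel Q y)
  φ_mono : ∀ y : ℝ, StrictMonoOn (φ y) (sublevel P y)
  ψ_mono : ∀ y : ℝ, StrictMonoOn (ψ y) (sublevel Q y)
  φ_nat : ∀ y y' : ℝ, y ≤ y' → ∀ t ∈ sublevel P y, φ y' t = φ y t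
  ψ_nat : ∀ y y' : ℝ, y ≤ y' → ∀ t ∈ sublevel Q y, ψ y' t = ψ y t
  triangle_φψ : ∀ y : ℝ, ∀ t ∈ sublevel P y, ψ (y + δ) (φ y t) = t
  triangle_ψφ : ∀ y : ℝ, ∀ t ∈ sublevel Q y, φ (y + δ) (ψ y t) = t

/-- Given a `δ`-interleaving `(φ, ψ)` of the sublevel
filtrations of 1D curves `P` and `Q`, with
`y* = max (sup (range P)) (sup (range Q)) + 2δ`, the map `μ := φ_{y*}` is a
`δ`-matching between `P` and `Q`: a continuous strictly increasing bijection
`[0,1] → [0,1]` with `|P x − Q (μ x)| ≤ δ` for all `x`. -/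
theorem interleaving_to_delta_matching (P Q : Set.Icc (0:ℝ) 1 → ℝ)
    (hP : Continuous P) (hQ : Continuous Q) (δ : ℝ) (hδ : 0 ≤ δ)
    (intl : SublevelInterleaving P Q δ)
    (ystar : ℝ)
    (hystar : ystar = max (sSup (Set.range P)) (sSup (Set.range Q)) + 2 * δ) :
    Continuous (intl.φ ystar) ∧ StrictMono (intl.φ ystar) ∧
      Function.Bijective (intl.φ ystar) ∧
      ∀ x : Set.Icc (0:ℝ) 1, |P x - Q (intl.φ ystar x)| ≤ δ := by
  have hPM : ∀ x, P x ≤ ystar - 2 * δ := fun x => by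
    have h := le_csSup (isCompact_range hP).bddAbove (Set.mem_range_self x)
    linarith [le_max_left (sSup (Set.range P)) (sSup (Set.range Q))]
  have hQM : ∀ z, Q z ≤ ystar - 2 * δ := fun z => by
    have h := le_csSup (isCompact_range hQ).bddAbove (Set.mem_range_self z)
    linarith [le_max_right (sSup (Set.range P)) (sSup (Set.range Q))]
  have hPy : ∀ x, x ∈ sublevel P ystar := fun x => (hPM x).trans (by linarith)
  have hmono : StrictMono (intl.φ ystar) := fun a b hab =>
    intl.φ_mono ystar (hPy a) (hPy b) hab
  refine ⟨continuousOn_univ.1 ((intl.φ_cont ystar).mono fun x _ => hPy x), hmono,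
    ⟨hmono.injective, fun z => ⟨intl.ψ (ystar - 2 * δ) z, ?_⟩⟩, fun x => abs_le.2 ⟨?_, ?_⟩⟩
  · rw [intl.φ_nat (ystar - 2 * δ + δ) ystar (by linarith) _ (intl.ψ_maps _ (hQM z)),
      intl.triangle_ψφ _ z (hQM z)]
  · have h : Q (intl.φ (P x) x) ≤ P x + δ := intl.φ_maps (P x) (le_refl (P x))
    rw [intl.φ_nat (P x) ystar (hPy x) x (le_refl (P x))]
    linarith
  · have h : P (intl.ψ (Q (intl.φ ystar x)) (intl.φ ystar x)) ≤ Q (intl.φ ystar x) + δ :=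
      intl.ψ_maps _ (le_refl (Q (intl.φ ystar x)))
    rw [← intl.ψ_nat _ (ystar + δ) (by linarith [hQM (intl.φ ystar x)]) _
      (le_refl (Q (intl.φ ystar x))), intl.triangle_φψ ystar x (hPy x)] at h
    linarith
end

section
/- Let P, Q : [0,1] → ℝ be 1D curves. Then the Fréchet distance equals the interleaving distance of the sublevel filtrations: d_F(P, Q) = inf { δ ≥ 0 : there exists a δ-interleaving of the sublevel filtrations of P and Q }. -/
/-- An order automorphism `e` of `[0,1]` with `|P t - Q (e t)| ≤ δ` restricts to a
`δ`-interleaving of the sublevel filtrations. -/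
def SublevelInterleaving.ofOrderIso {P Q : Set.Icc (0:ℝ) 1 → ℝ} {δ : ℝ}
    (e : Set.Icc (0:ℝ) 1 ≃o Set.Icc (0:ℝ) 1) (he : ∀ t, |P t - Q (e t)| ≤ δ) :
    SublevelInterleaving P Q δ where
  φ _ := e
  ψ _ := e.symm
  φ_maps y t ht := by
    have := abs_le.1 (he t)
    simp only [sublevel, Set.mem_ofPred_eq] at ht ⊢
    linarith
  ψ_maps y t ht := by
    have := abs_le.1 (he (e.symm t))
    simp only [sublevel, Set.mem_ofPred_eq, e.apply_symm_apply] at ht this ⊢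
    linarith
  φ_cont _ := e.continuous.continuousOn
  ψ_cont _ := e.symm.continuous.continuousOn
  φ_mono _ := e.strictMono.strictMonoOn _
  ψ_mono _ := e.symm.strictMono.strictMonoOn _
  φ_nat _ _ _ _ _ := rfl
  ψ_nat _ _ _ _ _ := rfl
  triangle_φψ _ t _ := e.symm_apply_apply t
  triangle_ψφ _ t _ := e.apply_symm_apply t

/-- The component of a `δ`-interleaving at a level bounding both curves is a `δ`-matching. -/
theorem SublevelInterleaving.exists_matching {P Q : Set.Icc (0:ℝ) 1 → ℝ} {δ M : ℝ}
    (I : SublevelInterleaving P Q δ) (hδ : 0 ≤ δ) (hP : ∀ t, P t ≤ M) (hQ : ∀ t, Q t ≤ M) :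
    ∃ μ : Set.Icc (0:ℝ) 1 → Set.Icc (0:ℝ) 1,
      Continuous μ ∧ StrictMono μ ∧ Function.Bijective μ ∧ ∀ t, |P t - Q (μ t)| ≤ δ := by
  have hP' : sublevel P M = Set.univ := Set.eq_univ_of_forall hP
  have left_inv (t) : I.ψ M (I.φ M t) = t := by
    rw [← I.ψ_nat M (M + δ) (by linarith) _ (hQ _), I.triangle_φψ M t (hP t)]
  have right_inv (t) : I.φ M (I.ψ M t) = t := by
    rw [← I.φ_nat M (M + δ) (by linarith) _ (hP _), I.triangle_ψφ M t (hQ t)]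
  refine ⟨I.φ M, ?_, ?_, ⟨Function.LeftInverse.injective left_inv,
    Function.RightInverse.surjective right_inv⟩, fun t => ?_⟩
  · simpa [hP'] using I.φ_cont M
  · simpa [hP'] using I.φ_mono M
  · have h₁ : Q (I.φ M t) ≤ P t + δ := by
      rw [I.φ_nat (P t) M (hP t) t (le_refl (P t))]
      exact I.φ_maps (P t) (le_refl (P t))
    have h₂ : P t ≤ Q (I.φ M t) + δ := by
      have h : P (I.ψ M (I.φ M t)) ≤ Q (I.φ M t) + δ := by
        rw [I.ψ_nat (Q (I.φ M t)) M (hQ _) _ (le_refl (Q (I.φ M t)))]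
        exact I.ψ_maps (Q (I.φ M t)) (le_refl (Q (I.φ M t)))
      rwa [left_inv] at h
    exact abs_le.2 ⟨by linarith, by linarith⟩

/-- The Fréchet distance between 1D curves `P` and `Q` (the
infimum of all `δ ≥ 0` admitting a `δ`-matching) equals the interleaving
distance of their sublevel filtrations (the infimum of all `δ ≥ 0` admitting a
`δ`-interleaving). -/
theorem frechet_eq_interleaving (P Q : Set.Icc (0:ℝ) 1 → ℝ)
    (hP : Continuous P) (hQ : Continuous Q) :
    sInf {δ : ℝ | 0 ≤ δ ∧ ∃ μ : Set.Icc (0:ℝ) 1 → Set.Icc (0:ℝ) 1,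
        Continuous μ ∧ StrictMono μ ∧ Function.Bijective μ ∧
        ∀ t : Set.Icc (0:ℝ) 1, |P t - Q (μ t)| ≤ δ} =
      sInf {δ : ℝ | 0 ≤ δ ∧ Nonempty (SublevelInterleaving P Q δ)} := by
  obtain ⟨A, hA⟩ := (isCompact_range hP).bddAbove
  obtain ⟨B, hB⟩ := (isCompact_range hQ).bddAbove
  congr 1
  ext δ
  refine and_congr_right fun hδ => ⟨?_, ?_⟩
  · rintro ⟨μ, -, hmono, hbij, hμ⟩
    exact ⟨.ofOrderIso (hmono.orderIsoOfSurjective μ hbij.surjective) hμ⟩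
  · rintro ⟨I⟩
    exact I.exists_matching (M := max A B) hδ
      (fun t => le_max_of_le_left (hA ⟨t, rfl⟩)) (fun t => le_max_of_le_right (hB ⟨t, rfl⟩))
end
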